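/- arXiv:2308.06171 — 2 statements merged into one kernel-verified Lean document; each statement's English description precedes it below -/
import Mathlib

section
/- For every integer n > d, the polynomial S_n has at least n−d sign changes in (a,b), i.e., there exist at least n−d points in (a,b) at which S_n changes sign (zeros of odd multiplicity). -/
open Polynomial MeasureTheory Finset

noncomputable section

/-- The `k`-th derivative of a real polynomial. -/
def iterDeriv (k : ℕ) (f : Polynomial ℝ) : Polynomial ℝ := Polynomial.derivative^[k] f

/-- The support of a Borel measure on `ℝ`. -/
def measSupport (μ : Measure ℝ) : Set ℝ :=
  {x | ∀ ε > 0, 0 < μ (Set.Ioo (x - ε) (x + ε))}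

/-- The discrete Sobolev-type inner product
`⟨f,g⟩_S = ∫ f g dμ + ∑_{j=1}^N ∑_{k=0}^{d_j} λ_{j,k} f^{(k)}(c_j) g^{(k)}(c_j)`. -/
def sobolevIP (μ : Measure ℝ) {N : ℕ} (c : Fin N → ℝ) (dd : Fin N → ℕ)
    (lam : Fin N → ℕ → ℝ) (f g : Polynomial ℝ) : ℝ :=
  (∫ x, f.eval x * g.eval x ∂μ) +
    ∑ j : Fin N, ∑ k ∈ Finset.range (dd j + 1),
      lam j k * (iterDeriv k f).eval (c j) * (iterDeriv k g).eval (c j)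

/-- A nonzero real polynomial all of whose zeros in `(a, b)` have even multiplicity has a constant
(weak) sign on `(a, b)`. -/
theorem eval_nonneg_or_nonpos_of_even_rootMultiplicity {a b : ℝ} (P : Polynomial ℝ) (hP : P ≠ 0)
    (heven : ∀ t ∈ Set.Ioo a b, Even (P.rootMultiplicity t)) :
    (∀ x ∈ Set.Ioo a b, 0 ≤ P.eval x) ∨ (∀ x ∈ Set.Ioo a b, P.eval x ≤ 0) := by
  induction hm : P.natDegree using Nat.strong_induction_on generalizing P with
  | _ m ih =>
  by_cases hroot : ∃ t ∈ Set.Ioo a b, P.IsRoot t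
  · obtain ⟨t, ht, hPt⟩ := hroot
    have hpos : 0 < P.rootMultiplicity t := (rootMultiplicity_pos hP).2 hPt
    have htwo : 2 ≤ P.rootMultiplicity t := by
      obtain ⟨r, hr⟩ := heven t ht
      omega
    obtain ⟨R, rfl⟩ := (le_rootMultiplicity_iff hP).1 htwo
    have hR : R ≠ 0 := right_ne_zero_of_mul hP
    have hdeg : ((X - C t) ^ 2 * R).natDegree = 2 + R.natDegree := by
      rw [natDegree_mul (left_ne_zero_of_mul hP) hR, natDegree_pow, natDegree_X_sub_C]
    have hRe : ∀ s ∈ Set.Ioo a b, Even (R.rootMultiplicity s) := by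
      intro s hs
      have h := heven s hs
      rw [rootMultiplicity_mul hP, sq,
        rootMultiplicity_mul (mul_self_ne_zero.2 (X_sub_C_ne_zero t)), Nat.even_add] at h
      exact h.1 (.add_self _)
    refine (ih _ (by omega) R hR hRe rfl).imp (fun h x hx => ?_) (fun h x hx => ?_)
    · simpa using mul_nonneg (sq_nonneg (x - t)) (h x hx)
    · simpa using mul_nonpos_of_nonneg_of_nonpos (sq_nonneg (x - t)) (h x hx)
  · push Not at hroot
    by_contra! hcon
    obtain ⟨⟨x, hx, hx0⟩, y, hy, hy0⟩ := hcon
    obtain ⟨z, hz, hz0⟩ := isPreconnected_Ioo.intermediate_value hx hy P.continuousOn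
      ⟨hx0.le, hy0.le⟩
    exact hroot z hz hz0

/-- Every polynomial is integrable against a measure with finite moments. -/
theorem integrable_eval_of_moments {μ : Measure ℝ}
    (hmom : ∀ m : ℕ, Integrable (fun x => x ^ m) μ) (f : Polynomial ℝ) :
    Integrable (fun x => f.eval x) μ := by
  simp only [eval_eq_sum_range]
  exact integrable_finsetSum _ fun i _ => (hmom i).const_mul _

theorem measSupport_eq_support (μ : Measure ℝ) : measSupport μ = μ.support := by
  ext x
  rw [(nhds_basis_Ioo_pos x).mem_measureSupport]
  rfl

/-- A measure on `ℝ` whose convex hull of the support has interior `(a, b)` and whose support is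
infinite is carried by `[a, b]`. -/
theorem measSupport_subset_Icc {μ : Measure ℝ} (hsupp : (measSupport μ).Infinite) {a b : ℝ}
    (hab : Set.Ioo a b = interior (convexHull ℝ (measSupport μ))) :
    a < b ∧ measSupport μ ⊆ Set.Icc a b := by
  obtain ⟨x, hx, y, hy, hxy⟩ := hsupp.nontrivial.exists_lt
  have hsub := subset_convexHull ℝ (measSupport μ)
  have hIoo : Set.Ioo x y ⊆ Set.Ioo a b := by
    rw [hab]
    refine interior_maximal (Set.Ioo_subset_Icc_self.trans ?_) isOpen_Ioo
    exact (convex_convexHull ℝ _).ordConnected.out (hsub hx) (hsub hy)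
  have hne : (Set.Ioo a b).Nonempty := (Set.nonempty_Ioo.2 hxy).mono hIoo
  have hlt : a < b := Set.nonempty_Ioo.1 hne
  refine ⟨hlt, ?_⟩
  rw [← closure_Ioo hlt.ne, hab,
    (convex_convexHull ℝ _).closure_interior_eq_closure_of_nonempty_interior (hab ▸ hne)]
  exact hsub.trans subset_closure

/-- A nonzero polynomial that is nonnegative on the support of `μ` has nonzero integral when the
support is infinite. -/
theorem integral_eval_ne_zero_of_nonneg_on_measSupport {μ : Measure ℝ}
    (hmom : ∀ m : ℕ, Integrable (fun x => x ^ m) μ) (hsupp : (measSupport μ).Infinite)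
    (P : Polynomial ℝ) (hP : P ≠ 0) (hnonneg : ∀ x ∈ measSupport μ, 0 ≤ P.eval x) :
    ∫ x, P.eval x ∂μ ≠ 0 := by
  intro hzero
  rw [measSupport_eq_support] at hsupp hnonneg
  have hae : 0 ≤ᵐ[μ] fun x => P.eval x := by
    filter_upwards [μ.support_mem_ae] with x hx using hnonneg x hx
  rw [integral_eq_zero_iff_of_nonneg_ae hae (integrable_eval_of_moments hmom P)] at hzero
  have hclosed : IsClosed {x | P.eval x = 0} := isClosed_eq P.continuous continuous_const
  refine hsupp ((P.rootSet_finite ℝ).subset fun x hx => ?_)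
  have := Measure.support_subset_of_isClosed hclosed hzero hx
  simpa [mem_rootSet, hP] using this

/-- The Sobolev inner product as a linear functional of its first argument. -/
def sobolevIPLeft (μ : Measure ℝ) (hmom : ∀ m : ℕ, Integrable (fun x => x ^ m) μ) {N : ℕ}
    (c : Fin N → ℝ) (dd : Fin N → ℕ) (lam : Fin N → ℕ → ℝ) (g : Polynomial ℝ) :
    Polynomial ℝ →ₗ[ℝ] ℝ where
  toFun f := sobolevIP μ c dd lam f g
  map_add' f₁ f₂ := by
    have hint (f : Polynomial ℝ) : Integrable (fun x => f.eval x * g.eval x) μ := by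
      simpa using integrable_eval_of_moments hmom (f * g)
    simp only [sobolevIP, iterDeriv, eval_add, iterate_map_add, add_mul, mul_add,
      sum_add_distrib]
    rw [integral_add (hint f₁) (hint f₂)]
    ring
  map_smul' r f := by
    simp only [sobolevIP, iterDeriv, eval_smul, iterate_derivative_smul, smul_eq_mul,
      RingHom.id_apply, mul_assoc, integral_const_mul, mul_add, mul_sum]
    simp only [mul_left_comm]

/-- A polynomial orthogonal to all lower monomials is orthogonal to all polynomials of lower
degree. -/
theorem sobolevIP_eq_zero_of_natDegree_lt {μ : Measure ℝ}
    (hmom : ∀ m : ℕ, Integrable (fun x => x ^ m) μ) {N : ℕ}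
    (c : Fin N → ℝ) (dd : Fin N → ℕ) (lam : Fin N → ℕ → ℝ) {n : ℕ} {g : Polynomial ℝ}
    (hg : ∀ m < n, sobolevIP μ c dd lam (X ^ m) g = 0) {f : Polynomial ℝ} (hf : f.natDegree < n) :
    sobolevIP μ c dd lam f g = 0 := by
  change sobolevIPLeft μ hmom c dd lam g f = 0
  rw [f.as_sum_range' n hf, map_sum]
  refine sum_eq_zero fun i hi => ?_
  rw [← smul_X_eq_monomial, map_smul]
  exact smul_eq_zero_of_right _ (hg i (mem_range.1 hi))

/-- If `f` vanishes to order `d_j + 1` at each `c_j`, the discrete part of the Sobolev inner product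
vanishes. -/
theorem sobolevIP_eq_integral_of_pow_dvd (μ : Measure ℝ) {N : ℕ} (c : Fin N → ℝ) (dd : Fin N → ℕ)
    (lam : Fin N → ℕ → ℝ) {f g : Polynomial ℝ} (hf : ∀ j, (X - C (c j)) ^ (dd j + 1) ∣ f) :
    sobolevIP μ c dd lam f g = ∫ x, f.eval x * g.eval x ∂μ := by
  refine add_eq_left.2 (sum_eq_zero fun j _ => sum_eq_zero fun k hk => ?_)
  have hk : k < dd j + 1 := mem_range.1 hk
  have hdvd : X - C (c j) ∣ iterDeriv k f :=
    (dvd_pow_self _ (by omega)).trans (pow_sub_dvd_iterate_derivative_of_pow_dvd k (hf j))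
  rw [dvd_iff_isRoot.1 hdvd, mul_zero, zero_mul]

theorem stmt2 (μ : Measure ℝ) [IsFiniteMeasure μ]
    (hmom : ∀ m : ℕ, Integrable (fun x => x ^ m) μ)
    (hsupp : (measSupport μ).Infinite)
    (a b : ℝ) (hab : Set.Ioo a b = interior (convexHull ℝ (measSupport μ)))
    (N : ℕ) (hN : 1 ≤ N)
    (c : Fin N → ℝ) (hc : Function.Injective c) (hcout : ∀ j, c j ∉ Set.Ioo a b)
    (dd : Fin N → ℕ) (hdd : Monotone dd)
    (lam : Fin N → ℕ → ℝ) (hlam : ∀ j k, 0 ≤ lam j k) (hlamd : ∀ j, 0 < lam j (dd j))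
    (d : ℕ) (hd : d = ∑ j, (dd j + 1))
    (n : ℕ) (hn : d < n)
    (Sn : Polynomial ℝ) (hSm : Sn.Monic) (hSd : Sn.natDegree = n)
    (hSo : ∀ m < n, sobolevIP μ c dd lam (X ^ m) Sn = 0) :
    ∃ T : Finset ℝ, n - d ≤ T.card ∧ (↑T : Set ℝ) ⊆ Set.Ioo a b ∧
      ∀ t ∈ T, Odd (Sn.rootMultiplicity t) := by
  classical
  obtain ⟨hlt, hsub⟩ := measSupport_subset_Icc hsupp hab
  have hSn : Sn ≠ 0 := hSm.ne_zero
  set T := Sn.roots.toFinset.filter fun t => t ∈ Set.Ioo a b ∧ Odd (Sn.rootMultiplicity t) with hT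
  have hmemT {t : ℝ} (ht : t ∈ Set.Ioo a b) : t ∈ T ↔ Odd (Sn.rootMultiplicity t) := by
    rw [hT, mem_filter, Multiset.mem_toFinset, ← count_roots]
    exact ⟨fun h => h.2.2, fun h => ⟨Multiset.count_pos.1 h.pos, ht, h⟩⟩
  refine ⟨T, ?_, fun t ht => (mem_filter.1 ht).2.1, fun t ht => (mem_filter.1 ht).2.2⟩
  by_contra! hcard
  set W : Polynomial ℝ := ∏ j, (X - C (c j)) ^ (dd j + 1)
  set q : Polynomial ℝ := ∏ t ∈ T, (X - C t)
  have hWm : W.Monic := monic_prod_of_monic _ _ fun j _ => (monic_X_sub_C _).pow _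
  have hqm : q.Monic := monic_prod_of_monic _ _ fun t _ => monic_X_sub_C t
  have hWd : W.natDegree = d := by
    rw [natDegree_prod_of_monic _ _ fun j _ => (monic_X_sub_C _).pow _, hd]
    simp
  have hqd : q.natDegree = T.card := by
    rw [natDegree_prod_of_monic _ _ fun t _ => monic_X_sub_C t]
    simp
  have hP : W * q * Sn ≠ 0 := ((hWm.mul hqm).mul hSm).ne_zero
  have hint : ∫ x, (W * q * Sn).eval x ∂μ = 0 := by
    have hdeg : (W * q).natDegree < n := by
      rw [hWm.natDegree_mul hqm]
      omega
    have horth := sobolevIP_eq_zero_of_natDegree_lt hmom c dd lam hSo hdeg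
    rw [sobolevIP_eq_integral_of_pow_dvd μ c dd lam fun j =>
      (dvd_prod_of_mem _ (mem_univ j)).mul_right q] at horth
    simpa only [eval_mul] using horth
  have heven : ∀ t ∈ Set.Ioo a b, Even ((W * q * Sn).rootMultiplicity t) := by
    intro t ht
    have hW0 : W.rootMultiplicity t = 0 := by
      refine rootMultiplicity_eq_zero fun h => ?_
      rw [IsRoot.def, eval_prod, prod_eq_zero_iff] at h
      obtain ⟨j, -, hj⟩ := h
      have htc : t = c j := by simpa [sub_eq_zero] using hj
      exact hcout j (htc ▸ ht)
    have hq : q.rootMultiplicity t = if t ∈ T then 1 else 0 := by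
      rw [← count_roots, roots_prod_X_sub_C, Multiset.count_eq_of_nodup T.nodup]
      rfl
    rw [rootMultiplicity_mul hP, rootMultiplicity_mul (hWm.mul hqm).ne_zero, hW0, hq, zero_add]
    have h := hmemT ht
    split_ifs with htT
    · exact odd_one.add_odd (h.1 htT)
    · simpa [h] using htT
  have hclosure {s : Set ℝ} (hs : IsClosed s)
      (h : ∀ x ∈ Set.Ioo a b, (W * q * Sn).eval x ∈ s) :
      ∀ x ∈ measSupport μ, (W * q * Sn).eval x ∈ s := by
    have hIcc : Set.Icc a b ⊆ (fun x => (W * q * Sn).eval x) ⁻¹' s := by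
      rw [← closure_Ioo hlt.ne]
      exact closure_minimal h (hs.preimage (W * q * Sn).continuous)
    exact fun x hx => hIcc (hsub hx)
  rcases eval_nonneg_or_nonpos_of_even_rootMultiplicity _ hP heven with h | h
  · exact integral_eval_ne_zero_of_nonneg_on_measSupport hmom hsupp _ hP
      (hclosure isClosed_Ici h) hint
  · refine integral_eval_ne_zero_of_nonneg_on_measSupport hmom hsupp _ (neg_ne_zero.2 hP)
      (fun x hx => ?_) ?_
    · rw [eval_neg]
      exact neg_nonneg.2 (hclosure isClosed_Iic h x hx)
    · simp only [eval_neg, integral_neg, hint, neg_zero]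
end
end

section
/- For every integer n ≥ 1 one has the identity of polynomials S_n(x) = P_n(x) − Σ_{(j,k)∈I₊} λ_{j,k} S_n^{(k)}(c_j) K_{n−1}^{(0,k)}(x, c_j), where K_{n−1}^{(0,k)}(x,y) = Σ_{i=0}^{n−1} P_i(x) P_i^{(k)}(y) / ‖P_i‖_μ². -/
open Polynomial MeasureTheory Finset

noncomputable section

theorem integrable_eval {μ : Measure ℝ} (hmom : ∀ m : ℕ, Integrable (fun x => x ^ m) μ)
    (f : ℝ[X]) : Integrable (fun x => f.eval x) μ := by
  simp only [eval_eq_sum_range]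
  exact integrable_finsetSum _ fun i _ => (hmom i).const_mul _

/-- Integration of polynomials against a measure with finite moments, as a linear functional. -/
def integralFunctional (μ : Measure ℝ) (hmom : ∀ m : ℕ, Integrable (fun x => x ^ m) μ) :
    ℝ[X] →ₗ[ℝ] ℝ where
  toFun f := ∫ x, f.eval x ∂μ
  map_add' f g := by
    simp only [eval_add]
    exact integral_add (integrable_eval hmom f) (integrable_eval hmom g)
  map_smul' a f := by
    simp only [eval_smul, smul_eq_mul, RingHom.id_apply]
    exact integral_const_mul a _

theorem integralFunctional_mul (μ : Measure ℝ) (hmom : ∀ m : ℕ, Integrable (fun x => x ^ m) μ)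
    (f g : ℝ[X]) :
    integralFunctional μ hmom (f * g) = ∫ x, f.eval x * g.eval x ∂μ := by
  simp [integralFunctional]

/-- Evaluation of the `k`-th derivative at a point, as a linear functional. -/
def iterDerivEval (k : ℕ) (a : ℝ) : ℝ[X] →ₗ[ℝ] ℝ where
  toFun f := (iterDeriv k f).eval a
  map_add' f g := by simp [iterDeriv, iterate_map_add]
  map_smul' b f := by simp [iterDeriv, iterate_derivative_smul]

@[simp]
theorem iterDerivEval_apply (k : ℕ) (a : ℝ) (f : ℝ[X]) :
    iterDerivEval k a f = (iterDeriv k f).eval a := rfl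

/-- A linear functional vanishing on monic polynomials of every degree below `n` vanishes on all
polynomials of degree below `n`. -/
theorem LinearMap.eq_zero_of_degree_lt (φ : ℝ[X] →ₗ[ℝ] ℝ) (B : ℕ → ℝ[X])
    (hBm : ∀ m, (B m).Monic) (hBd : ∀ m, (B m).natDegree = m) (n : ℕ)
    (hφ : ∀ m < n, φ (B m) = 0) (q : ℝ[X]) (hq : q.degree < n) : φ q = 0 := by
  induction n generalizing q with
  | zero =>
    have : q = 0 := by simpa using hq
    simp [this]
  | succ n ih =>
    have hr : (q - q.coeff n • B n).degree < n := by
      rw [degree_lt_iff_coeff_zero]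
      intro m hm
      have hBn : (B n).coeff n = 1 := by
        have := (hBm n).coeff_natDegree
        rwa [hBd] at this
      rcases hm.eq_or_lt with rfl | hm
      · simp [hBn]
      · have h1 : q.coeff m = 0 := (degree_lt_iff_coeff_zero _ _).1 hq m hm
        have h2 : (B n).coeff m = 0 := coeff_eq_zero_of_natDegree_lt (by rwa [hBd])
        simp [h1, h2]
    have h0 := ih (fun m hm => hφ m (by omega)) _ hr
    simpa [hφ n (by omega)] using h0

theorem eq_zero_of_integral_sq_eq_zero {μ : Measure ℝ}
    (hmom : ∀ m : ℕ, Integrable (fun x => x ^ m) μ) (hsupp : (measSupport μ).Infinite)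
    (f : ℝ[X]) (hf : ∫ x, f.eval x ^ 2 ∂μ = 0) : f = 0 := by
  by_contra hne
  obtain ⟨x, hx, hxr⟩ := hsupp.exists_notMem_finset f.roots.toFinset
  have hfx : f.eval x ≠ 0 := by simpa [hne] using hxr
  have hint : Integrable (fun x => f.eval x ^ 2) μ :=
    (integrable_eval hmom (f ^ 2)).congr (.of_forall fun x => eval_pow 2)
  have hae := (integral_eq_zero_iff_of_nonneg (fun x => sq_nonneg (f.eval x)) hint).1 hf
  have hopen : IsOpen {y | f.eval y ≠ 0} := isOpen_ne_fun f.continuous continuous_const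
  obtain ⟨ε, hε, hball⟩ := Metric.isOpen_iff.1 hopen x hfx
  rw [Real.ball_eq_Ioo] at hball
  refine (hx ε hε).ne' (measure_mono_null (fun y hy => ?_) hae)
  have := hball hy
  simpa using this

theorem stmt4 (μ : Measure ℝ) [IsFiniteMeasure μ]
    (hmom : ∀ m : ℕ, Integrable (fun x => x ^ m) μ)
    (hsupp : (measSupport μ).Infinite)
    (P : ℕ → Polynomial ℝ) (hPm : ∀ m, (P m).Monic) (hPd : ∀ m, (P m).natDegree = m)
    (hPo : ∀ m l, m ≠ l → ∫ x, (P m).eval x * (P l).eval x ∂μ = 0)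
    (h : ℕ → ℝ) (hh : ∀ m, h m = ∫ x, ((P m).eval x) ^ 2 ∂μ)
    (N : ℕ) (hN : 1 ≤ N)
    (c : Fin N → ℝ) (hc : Function.Injective c)
    (dd : Fin N → ℕ) (hdd : Monotone dd)
    (lam : Fin N → ℕ → ℝ) (hlam : ∀ j k, 0 ≤ lam j k) (hlamd : ∀ j, 0 < lam j (dd j))
    (S : ℕ → Polynomial ℝ) (hSm : ∀ m, (S m).Monic) (hSd : ∀ m, (S m).natDegree = m)
    (hSo : ∀ m l, l < m → sobolevIP μ c dd lam (X ^ l) (S m) = 0)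
    (n : ℕ) (hn : 1 ≤ n) :
    S n = P n - ∑ j : Fin N, ∑ k ∈ Finset.range (dd j + 1),
      Polynomial.C (lam j k * (iterDeriv k (S n)).eval (c j)) *
        ∑ i ∈ Finset.range n, Polynomial.C ((iterDeriv k (P i)).eval (c j) / h i) * P i := by
  set L := integralFunctional μ hmom with hL
  set φ : ℝ[X] →ₗ[ℝ] ℝ := L ∘ₗ LinearMap.mulRight ℝ (S n) +
    ∑ j : Fin N, ∑ k ∈ Finset.range (dd j + 1),
      (lam j k * (iterDeriv k (S n)).eval (c j)) • iterDerivEval k (c j) with hφ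
  have hφ_apply (f : ℝ[X]) : φ f = L (f * S n) + ∑ j : Fin N, ∑ k ∈ Finset.range (dd j + 1),
      lam j k * (iterDeriv k (S n)).eval (c j) * (iterDeriv k f).eval (c j) := by
    simp [hφ, LinearMap.sum_apply]
  have hφ_zero (m : ℕ) (hm : m < n) : φ (P m) = 0 := by
    refine LinearMap.eq_zero_of_degree_lt φ (fun i => X ^ i) (fun i => monic_X_pow i)
      (fun i => natDegree_X_pow i) n (fun l hl => ?_) (P m) ?_
    · rw [hφ_apply, ← hSo n l hl, sobolevIP, hL, integralFunctional_mul]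
      simp only [mul_right_comm]
    · rw [degree_eq_natDegree (hPm m).ne_zero, hPd]
      exact_mod_cast hm
  have hdegP (m : ℕ) : (P m).degree = m := by
    rw [degree_eq_natDegree (hPm m).ne_zero, hPd]
  have hh_ne (m : ℕ) : h m ≠ 0 := fun h0 =>
    (hPm m).ne_zero (eq_zero_of_integral_sq_eq_zero hmom hsupp _ (by rw [← hh, h0]))
  have hLP (m i : ℕ) : L (P m * P i) = if m = i then h m else 0 := by
    rw [hL, integralFunctional_mul]
    split_ifs with hmi
    · subst hmi
      simp only [hh, sq]
    · exact hPo m i hmi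
  set K : ℝ[X] := ∑ j : Fin N, ∑ k ∈ Finset.range (dd j + 1),
      Polynomial.C (lam j k * (iterDeriv k (S n)).eval (c j)) *
        ∑ i ∈ Finset.range n, Polynomial.C ((iterDeriv k (P i)).eval (c j) / h i) * P i with hK
  have hLK (m : ℕ) (hm : m < n) : L (P m * K) = ∑ j : Fin N, ∑ k ∈ Finset.range (dd j + 1),
      lam j k * (iterDeriv k (S n)).eval (c j) * (iterDeriv k (P m)).eval (c j) := by
    simp only [hK, ← smul_eq_C_mul, Finset.mul_sum, mul_smul_comm, map_sum, map_smul, hLP,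
      smul_eq_mul]
    refine Finset.sum_congr rfl fun j _ => Finset.sum_congr rfl fun k _ => ?_
    simp [hm]
    field_simp [hh_ne m]
  have hKdeg : K.degree < n := by
    rw [← mem_degreeLT]
    refine Submodule.sum_mem _ fun j _ => Submodule.sum_mem _ fun k _ => ?_
    rw [← smul_eq_C_mul]
    refine Submodule.smul_mem _ _ (Submodule.sum_mem _ fun i hi => ?_)
    rw [← smul_eq_C_mul]
    refine Submodule.smul_mem _ _ ?_
    rw [mem_degreeLT, hdegP]
    exact_mod_cast Finset.mem_range.1 hi
  have hSPdeg : (S n - P n).degree < n := by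
    have hdegS : (S n).degree = n := by
      rw [degree_eq_natDegree (hSm n).ne_zero, hSd]
    rw [← hdegS]
    exact degree_sub_lt_left (by rw [hdegS, hdegP]) (hSm n).ne_zero
      (by rw [(hSm n).leadingCoeff, (hPm n).leadingCoeff])
  set Q := S n - P n + K with hQ
  have hQdeg : Q.degree < n :=
    (degree_add_le _ _).trans_lt (max_lt hSPdeg hKdeg)
  have hLQ : L (Q * Q) = 0 := by
    refine LinearMap.eq_zero_of_degree_lt (L ∘ₗ LinearMap.mulRight ℝ Q) P hPm hPd n
      (fun m hm => ?_) Q hQdeg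
    have h1 := hφ_zero m hm
    rw [hφ_apply, ← hLK m hm] at h1
    simp only [LinearMap.comp_apply, LinearMap.mulRight_apply]
    rw [hQ, mul_add, mul_sub, map_add, map_sub, hLP, if_neg hm.ne]
    linarith
  have hQ0 : Q = 0 := by
    refine eq_zero_of_integral_sq_eq_zero hmom hsupp Q ?_
    rw [hL, integralFunctional_mul] at hLQ
    simpa only [sq] using hLQ
  linear_combination hQ0
end
end
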